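/- arXiv:1810.02227 — 3 statements merged into one kernel-verified Lean document; each statement's English description precedes it below -/
import Mathlib

section
/- For every number of rounds r with 1 ≤ r ≤ 24 and every valid r-round trajectory of activity patterns whose initial pattern b_0 is not identically false, the total active-function count of the trajectory is at least A(r), where A(1), A(2), …, A(24) = 0, 1, 2, 3, 4, 6, 8, 11, 14, 18, 22, 24, 27, 30, 32, 35, 36, 39, 41, 44, 45, 48, 50, 53. -/
/-- The block shuffle of the 16-branch generalized Feistel network (Randen):
position `k` receives the branch previously at position `shuffle k`. -/
def shuffle : Fin 16 → Fin 16 :=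
  ![7, 2, 13, 4, 11, 8, 3, 6, 15, 0, 9, 10, 1, 14, 5, 12]

/-- An activity pattern: `b k = true` means branch `k` carries a nonzero difference. -/
abbrev Pattern := Fin 16 → Bool

/-- The even branch `b (2 i)` feeding round function `i`. -/
def evenBr (b : Pattern) (i : Fin 8) : Bool := b ⟨2 * i.val, by have := i.isLt; omega⟩

/-- The odd branch `b (2 i + 1)` receiving the output of round function `i`. -/
def oddBr (b : Pattern) (i : Fin 8) : Bool := b ⟨2 * i.val + 1, by have := i.isLt; omega⟩

/-- The intermediate pattern `c` with `c (2 i) = b (2 i)` and `c (2 i + 1) = t i`. -/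
def combine (b : Pattern) (t : Fin 8 → Bool) : Pattern := fun k =>
  if k.val % 2 = 0 then b k else t ⟨k.val / 2, by have := k.isLt; omega⟩

/-- One round of truncated-differential propagation: `b` transforms into `b'` iff
there is `t : Fin 8 → Bool` with `t i = false` whenever both inputs of round
function `i` are inactive, `t i = true` whenever exactly one input is active
(`t i` is unconstrained if both inputs are active, since differences may cancel),
and `b' k = c (shuffle k)` where `c (2 i) = b (2 i)`, `c (2 i + 1) = t i`. -/
def Step (b b' : Pattern) : Prop :=
  ∃ t : Fin 8 → Bool,
    (∀ i : Fin 8,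
      ((evenBr b i = false ∧ oddBr b i = false) → t i = false) ∧
      (xor (evenBr b i) (oddBr b i) = true → t i = true)) ∧
    (∀ k : Fin 16, b' k = combine b t (shuffle k))

/-- Number of active functions of a pattern: the number of `i : Fin 8` with
`b (2 i) = true`. -/
def activeFuncs (b : Pattern) : ℕ :=
  (Finset.univ.filter fun i : Fin 8 => evenBr b i = true).card

/-- A valid `r`-round trajectory: each `b (j + 1)` arises from `b j` by one round. -/
def ValidTraj (r : ℕ) (b : ℕ → Pattern) : Prop :=
  ∀ j < r, Step (b j) (b (j + 1))

/-- Total active-function count of an `r`-round trajectory. -/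
def totalActive (r : ℕ) (b : ℕ → Pattern) : ℕ :=
  ∑ j ∈ Finset.range r, activeFuncs (b j)

/-- Lower bound on active functions after `r` rounds (Table in the paper),
indexed so that `activeBound 1 = 0`, ..., `activeBound 24 = 53`. -/
def activeBound : ℕ → ℕ := fun r =>
  [0, 1, 2, 3, 4, 6, 8, 11, 14, 18, 22, 24,
   27, 30, 32, 35, 36, 39, 41, 44, 45, 48, 50, 53].getD (r - 1) 0

/-- `forceNat n f = f n`, written by cases so that kernel reduction evaluates `n` to a numeral
before substituting it into `f`. -/
def forceNat {α : Type} (n : ℕ) (f : ℕ → α) : α :=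
  match n with
  | 0 => f 0
  | m + 1 => f m.succ

theorem forceNat_eq {α : Type} (n : ℕ) (f : ℕ → α) : forceNat n f = f n := by
  cases n <;> rfl

/-- The bitset of all `x < 2 ^ n` whose binary digit `k` is zero. -/
def clearMask : ℕ → ℕ → ℕ
  | 0, _ => 1
  | n + 1, k => bif Nat.beq n k then clearMask n k else clearMask n k * (2 ^ 2 ^ n + 1)

theorem clearMask_lt (n k : ℕ) : clearMask n k < 2 ^ 2 ^ n := by
  induction n with
  | zero => simp [clearMask]
  | succ n ih =>
    have hsq : 2 ^ 2 ^ (n + 1) = 2 ^ 2 ^ n * 2 ^ 2 ^ n := by rw [← pow_add]; ring_nf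
    rw [clearMask, hsq]
    generalize 2 ^ 2 ^ n = q at *
    cases Nat.beq n k
    · simp only [cond_false]; nlinarith
    · simp only [cond_true]; nlinarith

theorem testBit_clearMask (n k x : ℕ) :
    (clearMask n k).testBit x = (decide (x < 2 ^ n) && !x.testBit k) := by
  induction n generalizing x with
  | zero =>
    rcases x with _ | x
    · simp [clearMask]
    · simp [clearMask, Nat.testBit_succ]
  | succ n ih =>
    rw [clearMask]
    by_cases hnk : n = k
    · subst hnk
      simp only [Nat.beq_refl, cond_true, ih]
      by_cases hx : x < 2 ^ n
      · simp [hx, Nat.testBit_lt_two_pow hx, hx.trans (Nat.pow_lt_pow_succ one_lt_two)]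
      · by_cases hx' : x < 2 ^ (n + 1)
        · obtain ⟨y, rfl⟩ := Nat.exists_eq_add_of_le (not_lt.mp hx)
          have hy : y < 2 ^ n := by rw [pow_succ] at hx'; omega
          simp [Nat.testBit_two_pow_add_eq, Nat.testBit_lt_two_pow hy]
        · simp [hx, hx']
    · have hb : Nat.beq n k = false := by
        rw [← Bool.not_eq_true, Nat.beq_eq]; exact hnk
      rw [hb, cond_false, show clearMask n k * (2 ^ 2 ^ n + 1)
        = 2 ^ 2 ^ n * clearMask n k + clearMask n k by ring,
        Nat.testBit_two_pow_mul_add _ (clearMask_lt n k)]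
      by_cases hx : x < 2 ^ n
      · simp [hx, ih, hx.trans (Nat.pow_lt_pow_succ one_lt_two)]
      · obtain ⟨y, rfl⟩ := Nat.exists_eq_add_of_le (not_lt.mp hx)
        simp only [hx, if_false, Nat.add_sub_cancel_left, ih]
        have hlt : 2 ^ n + y < 2 ^ (n + 1) ↔ y < 2 ^ n := by rw [pow_succ]; omega
        by_cases hy : y < 2 ^ n
        · have h := Nat.testBit_two_pow_mul_add 1 hy k
          rw [mul_one] at h
          rw [h]
          rcases lt_or_gt_of_ne hnk with hk | hk
          · have : Nat.testBit 1 (k - n) = false := by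
              exact Nat.testBit_lt_two_pow (Nat.one_lt_two_pow (by omega))
            simp [hlt, hy, hk.not_gt, this,
              Nat.testBit_lt_two_pow (hy.trans (Nat.pow_lt_pow_right one_lt_two hk))]
          · simp [hlt, hy, hk]
        · simp [hlt, hy]

/-- The number encoding the pattern `a` (low 16 binary digits) with remaining budget `m`. -/
def slot (a : Pattern) (m : ℕ) : ℕ := 2 ^ 16 * m + Nat.ofBits a

theorem testBit_slot (a : Pattern) (m : ℕ) (k : Fin 16) : (slot a m).testBit k = a k := by
  rw [slot, Nat.testBit_two_pow_mul_add _ (Nat.ofBits_lt_two_pow a)]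
  simp

theorem slot_succ (a : Pattern) (m : ℕ) : slot a (m + 1) = 2 ^ 16 + slot a m := by
  simp only [slot]; ring

theorem testBit_clearMask_slot {a : Pattern} {m : ℕ} (hm : m < 64) (k : Fin 16) :
    (clearMask 22 k).testBit (slot a m) = !a k := by
  have := Nat.ofBits_lt_two_pow a
  have hlt : slot a m < 2 ^ 22 := by rw [slot]; omega
  rw [testBit_clearMask, testBit_slot, decide_eq_true hlt, Bool.true_and]

theorem ofBits_update_true {n : ℕ} (a : Fin n → Bool) (o : Fin n) (ho : a o = false) :
    Nat.ofBits (Function.update a o true) = 2 ^ (o : ℕ) + Nat.ofBits a := by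
  induction n with
  | zero => exact o.elim0
  | succ n ih =>
    refine Fin.cases (fun ho => ?_) (fun o ho => ?_) o ho
    · have : Function.update a 0 true ∘ Fin.succ = a ∘ Fin.succ := by
        ext i; simp [Fin.succ_ne_zero]
      simp [Nat.ofBits_succ, this, ho, add_comm]
    · have : Function.update a o.succ true ∘ Fin.succ = Function.update (a ∘ Fin.succ) o true :=
        Function.update_comp_eq_of_injective a (Fin.succ_injective n) o true
      rw [Nat.ofBits_succ, this, ih _ _ (by simpa using ho), Nat.ofBits_succ,
        Function.update_of_ne (Fin.succ_ne_zero o).symm, Fin.val_succ]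
      ring

theorem slot_update_true (a : Pattern) (m : ℕ) {o : Fin 16} (ho : a o = false) :
    slot (Function.update a o true) m = 2 ^ (o : ℕ) + slot a m := by
  rw [slot, slot, ofBits_update_true a o ho]; ring

theorem slot_update_false (a : Pattern) (m : ℕ) {o : Fin 16} (ho : a o = true) :
    slot a m = 2 ^ (o : ℕ) + slot (Function.update a o false) m := by
  rw [← slot_update_true _ m (Function.update_self o false a), Function.update_idem, ← ho,
    Function.update_eq_self]

/-- The image of a bitset of slots under one round function with input at position `e` and
output at position `o`: an active input costs one unit of budget, and slots without budget
are dropped. -/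
def funcImage (e o S : ℕ) : ℕ :=
  forceNat S fun S =>
  let u := S &&& clearMask 22 e
  let x := S ^^^ u
  let z := x &&& clearMask 22 o
  let y := x ^^^ z
  u ||| ((y ||| z <<< 2 ^ o ||| y >>> 2 ^ o) >>> 2 ^ 16)

theorem testBit_funcImage {S m : ℕ} {a : Pattern} {e o : Fin 16} {v : Bool}
    (hm : m + (a e).toNat < 64) (hS : S.testBit (slot a (m + (a e).toNat)) = true)
    (hfalse : a e = false ∧ a o = false → v = false) (htrue : xor (a e) (a o) = true → v = true) :
    (funcImage e o S).testBit (slot (Function.update a o v) m) = true := by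
  simp only [funcImage, forceNat_eq]
  cases he : a e
  · have hv : v = a o := by
      cases ho : a o
      · exact hfalse ⟨he, ho⟩
      · exact htrue (by simp [he, ho])
    rw [hv, Function.update_eq_self]
    simp only [he, Bool.toNat_false, add_zero] at hS hm
    simp [hS, testBit_clearMask_slot hm, he]
  · simp only [he, Bool.toNat_true] at hS hm
    have hx := testBit_clearMask_slot (a := a) hm
    rw [Nat.testBit_or, Nat.testBit_shiftRight, ← slot_succ]
    cases ho : a o
    · obtain rfl := htrue (by simp [he, ho])
      simp only [Nat.testBit_or, Nat.testBit_shiftLeft, slot_update_true _ (m + 1) ho]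
      simp [hS, hx, he, ho]
    · cases v
      · have h := slot_update_false a (m + 1) ho
        simp only [Nat.testBit_or, Nat.testBit_shiftRight, ← h]
        simp [hS, hx, he, ho]
      · rw [← ho, Function.update_eq_self]
        simp [hS, hx, he, ho]

/-- The image of a bitset under the first `n` round functions of round `j`. Branches are not
moved: branch `k` of round `j` is kept at position `shuffle^[j] k`. -/
def partialRound (j : ℕ) : ℕ → ℕ → ℕ
  | 0, S => S
  | n + 1, S =>
    forceNat (shuffle^[j] (Fin.ofNat 16 (2 * n))).val fun e =>
    forceNat (shuffle^[j] (Fin.ofNat 16 (2 * n + 1))).val fun o =>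
    funcImage e o (partialRound j n S)

/-- The bitset of all `2 ^ n * m + x` with `0 < x < 2 ^ n`. -/
def nonzeroSlots (n m : ℕ) : ℕ := (2 ^ 2 ^ n - 2) <<< (2 ^ n * m)

theorem testBit_nonzeroSlots {n : ℕ} (m : ℕ) {b : Fin n → Bool} (hb : ∃ k, b k = true) :
    (nonzeroSlots n m).testBit (2 ^ n * m + Nat.ofBits b) = true := by
  obtain ⟨k, hk⟩ := hb
  have hne : Nat.ofBits b ≠ 0 := by
    intro h0
    have := Nat.testBit_ofBits_lt b k k.isLt
    simp [h0, hk] at this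
  obtain ⟨c, hc⟩ := Nat.exists_eq_succ_of_ne_zero hne
  have hshift : (nonzeroSlots n m).testBit (2 ^ n * m + Nat.ofBits b)
      = (2 ^ 2 ^ n - (1 + 1)).testBit (Nat.ofBits b) := by
    simp [nonzeroSlots]
  rw [hshift, Nat.testBit_two_pow_sub_succ (Nat.one_lt_two_pow (by positivity)),
    decide_eq_true (Nat.ofBits_lt_two_pow b), hc]
  simp [Nat.testBit_succ]

/-- The slots at the start of round `j` reachable from nonzero patterns with budget `52`. -/
def reachable : ℕ → ℕ
  | 0 => nonzeroSlots 16 52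
  | j + 1 => partialRound j 8 (reachable j)

/-- Check, for `fuel` consecutive rounds from round `j` on, that every slot in the bitset has
spent at least `activeBound` units of its budget. -/
def verifyFrom : ℕ → ℕ → ℕ → Bool
  | 0, _, _ => true
  | fuel + 1, j, S => forceNat S fun S =>
    Nat.ble (S + 1) (2 ^ (2 ^ 16 * (53 - activeBound j))) &&
      verifyFrom fuel (j + 1) (partialRound j 8 S)

theorem verifyFrom_start : verifyFrom 25 0 (reachable 0) = true := by
  decide +kernel

theorem lt_of_verifyFrom {fuel j : ℕ} (h : verifyFrom fuel j (reachable j) = true) {i : ℕ}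
    (hi : i < fuel) : reachable (j + i) < 2 ^ (2 ^ 16 * (53 - activeBound (j + i))) := by
  induction fuel generalizing j i with
  | zero => omega
  | succ fuel ih =>
    rw [verifyFrom, forceNat_eq, Bool.and_eq_true] at h
    rcases i with _ | i
    · exact Nat.le_of_ble_eq_true h.1
    · have := ih (j := j + 1) h.2 (i := i) (by omega)
      rwa [Nat.add_right_comm, Nat.add_assoc] at this

/-- The pattern `b` with the first `n` odd branches replaced by the outputs `t`. -/
def partialCombine (b : Pattern) (t : Fin 8 → Bool) (n : ℕ) : Pattern := fun k =>
  if k.val % 2 = 1 ∧ k.val / 2 < n then t ⟨k.val / 2, by have := k.isLt; omega⟩ else b k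

theorem partialCombine_eight (b : Pattern) (t : Fin 8 → Bool) :
    partialCombine b t 8 = combine b t := by
  ext k
  have := k.isLt
  rcases Nat.mod_two_eq_zero_or_one k.val with h | h
  · simp [partialCombine, combine, h]
  · simp [partialCombine, combine, h, show k.val / 2 < 8 by omega]

theorem partialCombine_succ (b : Pattern) (t : Fin 8 → Bool) (i : Fin 8) :
    partialCombine b t (i + 1) =
      Function.update (partialCombine b t i) (Fin.ofNat 16 (2 * i + 1)) (t i) := by
  ext k
  by_cases hk : k = Fin.ofNat 16 (2 * i + 1)
  · subst hk
    have : (2 * i.val + 1) % 16 = 2 * i.val + 1 := by omega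
    have h2 : (2 * i.val + 1) / 2 = i.val := by omega
    simp [partialCombine, this, h2, Nat.add_mod]
  · have hne : ¬ (k.val % 2 = 1 ∧ k.val / 2 = i.val) := by
      rintro ⟨h1, h2⟩
      apply hk
      ext
      simp only [Fin.ofNat]
      omega
    have hiff : (k.val % 2 = 1 ∧ k.val / 2 < i.val + 1) ↔ (k.val % 2 = 1 ∧ k.val / 2 < i.val) := by
      omega
    simp only [Function.update_of_ne hk, partialCombine, hiff]

theorem shuffle_injective : Function.Injective shuffle := by decide

theorem activeFuncs_eq_sum (b : Pattern) :
    activeFuncs b = ∑ i ∈ Finset.range 8, (b (Fin.ofNat 16 (2 * i))).toNat := by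
  rw [Finset.sum_range, activeFuncs, Finset.card_filter]
  refine Finset.sum_congr rfl fun i _ => ?_
  have : Fin.ofNat 16 (2 * i.val) = ⟨2 * i.val, by omega⟩ := by ext; simp [Fin.ofNat]; omega
  rw [this, evenBr]
  cases b ⟨2 * i.val, by omega⟩ <;> rfl

/-- The bitset `S` contains the pattern `b` of round `j` with remaining budget `m`. -/
def Holds (j S m : ℕ) (b : Pattern) : Prop :=
  ∃ a : Pattern, (∀ k, a (shuffle^[j] k) = b k) ∧ S.testBit (slot a m) = true

theorem holds_partialRound {j S m : ℕ} {b : Pattern} {t : Fin 8 → Bool}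
    (ht : ∀ i : Fin 8, ((evenBr b i = false ∧ oddBr b i = false) → t i = false) ∧
      (xor (evenBr b i) (oddBr b i) = true → t i = true)) {n : ℕ} (hn : n ≤ 8)
    (hm : m + ∑ i ∈ Finset.range n, (b (Fin.ofNat 16 (2 * i))).toNat < 64)
    (h : Holds j S (m + ∑ i ∈ Finset.range n, (b (Fin.ofNat 16 (2 * i))).toNat) b) :
    Holds j (partialRound j n S) m (partialCombine b t n) := by
  induction n generalizing m with
  | zero =>
    have hb : partialCombine b t 0 = b := by ext k; simp [partialCombine]
    simpa [partialRound, hb] using h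
  | succ n ih =>
    rw [Finset.sum_range_succ, add_comm (Finset.sum _ _), ← add_assoc] at h hm
    obtain ⟨a, ha, hS⟩ := ih (by omega) hm h
    let i : Fin 8 := ⟨n, hn⟩
    have he : partialCombine b t n (Fin.ofNat 16 (2 * n)) = b (Fin.ofNat 16 (2 * n)) := by
      have : (2 * n) % 16 % 2 = 0 := by omega
      simp [partialCombine, this]
    have ho : partialCombine b t n (Fin.ofNat 16 (2 * n + 1)) = b (Fin.ofNat 16 (2 * n + 1)) := by
      have : ¬ (2 * n + 1) % 16 / 2 < n := by omega
      simp [partialCombine, this]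
    have he' : evenBr b i = b (Fin.ofNat 16 (2 * n)) := by
      rw [evenBr]; congr 1; ext; simp [Fin.ofNat, i]; omega
    have ho' : oddBr b i = b (Fin.ofNat 16 (2 * n + 1)) := by
      rw [oddBr]; congr 1; ext; simp [Fin.ofNat, i]; omega
    refine ⟨Function.update a (shuffle^[j] (Fin.ofNat 16 (2 * n + 1))) (t i), fun k => ?_, ?_⟩
    · rw [show n = i.val from rfl, partialCombine_succ]
      rw [← Function.comp_apply (f := Function.update _ _ _),
        Function.update_comp_eq_of_injective a (shuffle_injective.iterate j)]
      congr 1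
      ext k
      exact ha k
    · simp only [partialRound, forceNat_eq]
      have hae := (ha (Fin.ofNat 16 (2 * n))).trans he
      have hao := (ha (Fin.ofNat 16 (2 * n + 1))).trans ho
      apply testBit_funcImage
      · rw [hae]; omega
      · rwa [hae]
      · rw [hae, hao, ← he', ← ho']; exact (ht i).1
      · rw [hae, hao, ← he', ← ho']; exact (ht i).2

theorem holds_step {j S m : ℕ} {b b' : Pattern} (hstep : Step b b')
    (hm : m + activeFuncs b < 64) (h : Holds j S (m + activeFuncs b) b) :
    Holds (j + 1) (partialRound j 8 S) m b' := by
  obtain ⟨t, ht, hb'⟩ := hstep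
  rw [activeFuncs_eq_sum] at hm h
  obtain ⟨a, ha, hS⟩ := holds_partialRound ht le_rfl hm h
  refine ⟨a, fun k => ?_, hS⟩
  rw [Function.iterate_succ_apply, ha, partialCombine_eight, hb']

theorem holds_reachable_zero {b : Pattern} (hb : ∃ k, b k = true) :
    Holds 0 (reachable 0) 52 b :=
  ⟨b, fun _ => rfl, testBit_nonzeroSlots 52 hb⟩

theorem holds_reachable {r m : ℕ} {b : ℕ → Pattern} (hb : ∃ k, b 0 k = true)
    (hv : ValidTraj r b) (hm : m + totalActive r b = 52) : Holds r (reachable r) m (b r) := by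
  induction r generalizing m with
  | zero =>
    obtain rfl : m = 52 := by simpa [totalActive] using hm
    exact holds_reachable_zero hb
  | succ r ih =>
    rw [totalActive, Finset.sum_range_succ, ← totalActive] at hm
    exact holds_step (hv r r.lt_succ_self) (by omega)
      (ih (fun j hj => hv j (hj.trans r.lt_succ_self)) (by omega))

theorem activeBound_le (r : ℕ) (hr : r ≤ 24) : activeBound r ≤ 53 := by
  revert r; decide

theorem active_functions_lower_bound :
    ∀ r : ℕ, 1 ≤ r → r ≤ 24 → ∀ b : ℕ → Pattern,
      ValidTraj r b → (∃ k, b 0 k = true) →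
      activeBound r ≤ totalActive r b := by
  intro r _ hr b hv hb
  by_contra! hlt
  have hle := activeBound_le r hr
  obtain ⟨a, -, ha⟩ := holds_reachable (m := 52 - totalActive r b) hb hv (by omega)
  have hbound := lt_of_verifyFrom verifyFrom_start (i := r) (by omega)
  rw [Nat.zero_add] at hbound
  have hslot : 2 ^ 16 * (53 - activeBound r) ≤ slot a (52 - totalActive r b) := by
    rw [slot]; omega
  rw [Nat.testBit_lt_two_pow (hbound.trans_le (Nat.pow_le_pow_right two_pos hslot))] at ha
  exact Bool.false_ne_true ha
end

section
/- Every valid 6-round trajectory of activity patterns whose initial pattern b_0 is not identically false has total active-function count at least 6. -/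
open Finset

/-- Number of active entries of a vector of eight branches. -/
def weight (u : Fin 8 → Bool) : ℕ := #{i | u i = true}

/-- The round function whose odd output branch moves to even position `2 k`. -/
noncomputable def evenSource : Equiv.Perm (Fin 8) :=
  Equiv.ofBijective ![3, 6, 5, 1, 7, 4, 0, 2] (by decide)

/-- The round function whose even branch moves to odd position `2 k + 1`. -/
noncomputable def oddSource : Equiv.Perm (Fin 8) :=
  Equiv.ofBijective ![1, 2, 4, 3, 0, 5, 7, 6] (by decide)

theorem evenSource_ne_oddSource (k : Fin 8) : evenSource k ≠ oddSource k := by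
  simp only [evenSource, oddSource, Equiv.ofBijective_apply]
  revert k
  decide

/-- At no index is exactly one of the three vectors active. -/
def NoLone (u v w : Fin 8 → Bool) : Prop :=
  ∀ i, (u i = true → v i = true ∨ w i = true) ∧ (v i = true → u i = true ∨ w i = true) ∧
    (w i = true → u i = true ∨ v i = true)

theorem NoLone.rotate {u v w : Fin 8 → Bool} (h : NoLone u v w) : NoLone v w u := by
  intro i
  have := h i
  tauto

theorem NoLone.swap {u v w : Fin 8 → Bool} (h : NoLone u v w) : NoLone u w v := by
  intro i
  have := h i
  tauto

theorem NoLone.weight_le {u v w : Fin 8 → Bool} (h : NoLone u v w) :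
    weight u ≤ weight v + weight w := by
  refine (card_le_card fun i hi => ?_).trans (card_union_le _ _)
  simpa using (h i).1 (by simpa using hi)

theorem NoLone.weight_add_le_of_disjoint {u v w : Fin 8 → Bool} (h : NoLone u v w)
    (huv : ∀ i, u i = true → v i ≠ true) : weight u + weight v ≤ weight w := by
  unfold weight
  rw [← card_union_of_disjoint (disjoint_filter.2 fun i _ => huv i)]
  refine card_le_card fun i hi => ?_
  have := h i
  have := huv i
  simp only [mem_union, mem_filter, mem_univ, true_and] at hi ⊢
  tauto

theorem NoLone.eq_of_weight_eq_zero {u v w : Fin 8 → Bool} (h : NoLone u v w)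
    (hw : weight w = 0) : u = v := by
  funext i
  have hwi : w i ≠ true := fun hi => by simp_all [weight]
  have := h i
  rw [Bool.eq_iff_iff]
  tauto

theorem weight_comp (u : Fin 8 → Bool) (p : Equiv.Perm (Fin 8)) :
    weight (fun k => u (p k)) = weight u :=
  card_equiv p (by simp)

theorem eq_of_weight_eq_one {u : Fin 8 → Bool} (hu : weight u = 1) {i j : Fin 8}
    (hi : u i = true) (hj : u j = true) : i = j :=
  card_le_one.1 hu.le i (by simpa using hi) j (by simpa using hj)

theorem weight_pos {u : Fin 8 → Bool} {i : Fin 8} (hi : u i = true) : 0 < weight u :=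
  card_pos.2 ⟨i, by simpa using hi⟩

/-- A round in terms of the even and odd halves of the pattern. -/
theorem Step.exists_noLone {b b' : Pattern} (h : Step b b') :
    ∃ t, NoLone (evenBr b) (oddBr b) t ∧ evenBr b' = (fun k => t (evenSource k)) ∧
      oddBr b' = fun k => evenBr b (oddSource k) := by
  obtain ⟨t, ht, hb⟩ := h
  refine ⟨t, fun i => ?_, funext fun k => ?_, funext fun k => ?_⟩
  · have := ht i
    revert this
    cases evenBr b i <;> cases oddBr b i <;> cases t i <;> simp
  · rw [evenBr, hb]
    fin_cases k <;> rfl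
  · rw [oddBr, hb]
    fin_cases k <;> rfl

theorem Step.weight_oddBr {b b' : Pattern} (h : Step b b') :
    weight (oddBr b') = weight (evenBr b) := by
  obtain ⟨t, -, -, ho⟩ := h.exists_noLone
  rw [ho, weight_comp]

theorem Step.weight_triangle {b b' : Pattern} (h : Step b b') :
    weight (evenBr b) ≤ weight (oddBr b) + weight (evenBr b') ∧
      weight (oddBr b) ≤ weight (evenBr b') + weight (evenBr b) ∧
      weight (evenBr b') ≤ weight (evenBr b) + weight (oddBr b) := by
  obtain ⟨t, hn, he, -⟩ := h.exists_noLone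
  rw [he, weight_comp]
  exact ⟨hn.weight_le, hn.rotate.weight_le, hn.rotate.rotate.weight_le⟩

/-- A single active even branch spreads to two active functions after two rounds. -/
theorem Step.two_le_weight_evenBr {b b' b'' : Pattern} (h : Step b b') (h' : Step b' b'')
    (ho : weight (oddBr b) = 0) (he : weight (evenBr b) = 1) : 2 ≤ weight (evenBr b'') := by
  obtain ⟨t, hn, he', ho'⟩ := h.exists_noLone
  obtain ⟨t', hn', he'', -⟩ := h'.exists_noLone
  obtain rfl := hn.swap.eq_of_weight_eq_zero ho
  have hle := hn'.weight_add_le_of_disjoint fun k hk hk' => evenSource_ne_oddSource k <|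
    eq_of_weight_eq_one he (by simpa [he'] using hk) (by simpa [ho'] using hk')
  rw [he', ho', weight_comp, weight_comp] at hle
  rw [he'', weight_comp]
  omega

/-- A single active even branch that leaves no active function in the next round arises
from two active odd branches one round earlier. -/
theorem Step.two_le_weight_oddBr {b b' b'' : Pattern} (h : Step b b') (h' : Step b' b'')
    (he'' : weight (evenBr b'') = 0) (he' : weight (evenBr b') = 1) :
    2 ≤ weight (oddBr b) := by
  obtain ⟨t, hn, het, hot⟩ := h.exists_noLone
  obtain ⟨t', hn', het', -⟩ := h'.exists_noLone
  rw [het', weight_comp] at he''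
  have heq := hn'.eq_of_weight_eq_zero he''
  have he : weight (evenBr b) = 1 := by rw [← h.weight_oddBr, ← heq, he']
  have ht : weight t = 1 := by rw [← he', het, weight_comp]
  have hle := hn.swap.weight_add_le_of_disjoint fun i hi hi' => by
    obtain ⟨k, rfl⟩ := evenSource.surjective i
    have hk : evenBr b (oddSource k) = true := by
      rw [← congrFun hot k, ← heq, het]
      exact hi'
    exact evenSource_ne_oddSource k (eq_of_weight_eq_one he hi hk)
  omega

theorem weight_pos_of_exists {b : Pattern} (h : ∃ k, b k = true) :
    0 < weight (evenBr b) + weight (oddBr b) := by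
  obtain ⟨k, hk⟩ := h
  rcases Nat.mod_two_eq_zero_or_one k.val with hmod | hmod
  · have : evenBr b ⟨k.val / 2, by omega⟩ = true := by
      rw [← hk, evenBr]
      congr 1
      ext
      dsimp only
      omega
    have := weight_pos this
    omega
  · have : oddBr b ⟨k.val / 2, by omega⟩ = true := by
      rw [← hk, oddBr]
      congr 1
      ext
      dsimp only
      omega
    have := weight_pos this
    omega

theorem six_rounds_at_least_six_active :
    ∀ b : ℕ → Pattern, ValidTraj 6 b → (∃ k, b 0 k = true) →
      6 ≤ totalActive 6 b := by
  intro b hb h0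
  have hpos := weight_pos_of_exists h0
  have step (j : ℕ) (hj : j < 6) := hb j hj
  have odd (j : ℕ) (hj : j < 6) := (step j hj).weight_oddBr
  have tri (j : ℕ) (hj : j < 6) := (step j hj).weight_triangle
  have fwd (j : ℕ) (hj : j + 1 < 6) :=
    (step j (by omega)).two_le_weight_evenBr (step (j + 1) hj)
  have bwd (j : ℕ) (hj : j + 1 < 6) :=
    (step j (by omega)).two_le_weight_oddBr (step (j + 1) hj)
  have total : totalActive 6 b = ∑ j ∈ range 6, weight (evenBr (b j)) := rfl
  rw [total]
  simp only [sum_range_succ, sum_range_zero, zero_add]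
  have o0 := odd 0 (by omega)
  have o1 := odd 1 (by omega)
  have o2 := odd 2 (by omega)
  have o3 := odd 3 (by omega)
  have t0 := tri 0 (by omega)
  have t1 := tri 1 (by omega)
  have t2 := tri 2 (by omega)
  have t3 := tri 3 (by omega)
  have t4 := tri 4 (by omega)
  have f1 := fwd 1 (by omega)
  have f2 := fwd 2 (by omega)
  have f3 := fwd 3 (by omega)
  have b1 := bwd 1 (by omega)
  have b2 := bwd 2 (by omega)
  have b3 := bwd 3 (by omega)
  simp only [Nat.reduceAdd, zero_add] at *
  omega
end

section
/- There exists a valid 6-round trajectory of activity patterns whose initial pattern is not identically false and whose total active-function count is exactly 6; consequently, the minimum total active-function count over all valid 6-round trajectories with initial pattern not identically false equals 6. -/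
/-- The coordinate relation between the active sets of three consecutive rounds: for every `i`,
the number of true statements among `r i ∈ A`, `p i ∈ B`, `i ∈ C` is not exactly one. -/
structure Linked {α : Type*} (p r : Equiv.Perm α) (A B C : Finset α) : Prop where
  last : ∀ i ∈ C, p i ∈ B ∨ r i ∈ A
  middle : ∀ i, p i ∈ B → i ∈ C ∨ r i ∈ A
  first : ∀ i, r i ∈ A → i ∈ C ∨ p i ∈ B

namespace Linked

variable {α : Type*} {p r : Equiv.Perm α} {A B C D : Finset α}

theorem card_last_le [DecidableEq α] (h : Linked p r A B C) : C.card ≤ B.card + A.card := by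
  have hsub : C ⊆ B.map p.symm.toEmbedding ∪ A.map r.symm.toEmbedding := fun i hi => by
    simpa [Finset.mem_map_equiv] using h.last i hi
  simpa using (Finset.card_le_card hsub).trans (Finset.card_union_le _ _)

theorem card_middle_le [DecidableEq α] (h : Linked p r A B C) : B.card ≤ C.card + A.card := by
  have hsub : B.map p.symm.toEmbedding ⊆ C ∪ A.map r.symm.toEmbedding := fun i hi => by
    simpa [Finset.mem_map_equiv] using h.middle i (by simpa [Finset.mem_map_equiv] using hi)
  simpa using (Finset.card_le_card hsub).trans (Finset.card_union_le _ _)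

theorem card_first_le [DecidableEq α] (h : Linked p r A B C) : A.card ≤ C.card + B.card := by
  have hsub : A.map r.symm.toEmbedding ⊆ C ∪ B.map p.symm.toEmbedding := fun i hi => by
    simpa [Finset.mem_map_equiv] using h.first i (by simpa [Finset.mem_map_equiv] using hi)
  simpa using (Finset.card_le_card hsub).trans (Finset.card_union_le _ _)

/-- After an empty set, two singletons are followed by at least two active elements. -/
theorem two_le_card_last (hpr : ∀ i, p (p i) ≠ r i) (h : Linked p r A B C)
    (h' : Linked p r B C D) (hA : A.card = 0) (hB : B.card = 1) (hC : C.card = 1) :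
    2 ≤ D.card := by
  obtain rfl := Finset.card_eq_zero.mp hA
  obtain ⟨b, rfl⟩ := Finset.card_eq_one.mp hB
  obtain ⟨c, rfl⟩ := Finset.card_eq_one.mp hC
  obtain rfl : p c = b := by simpa using h.last c
  have hu : p.symm c ∈ D := by
    have hne := hpr (p.symm c)
    simp only [Equiv.apply_symm_apply] at hne
    simpa [hne.symm] using h'.middle (p.symm c)
  have hne : p (r.symm (p c)) ≠ c := fun e => by
    have := hpr (r.symm (p c))
    simp [e] at this
  have hv : r.symm (p c) ∈ D := by simpa [hne] using h'.first (r.symm (p c))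
  exact Finset.one_lt_card.mpr ⟨_, hu, _, hv, fun e => hne (by simp [← e])⟩

/-- Before two singletons and an empty set there are at least two active elements. -/
theorem two_le_card_first (hpr : ∀ i, p (p i) ≠ r i) (h : Linked p r A B C)
    (h' : Linked p r B C D) (hB : B.card = 1) (hC : C.card = 1) (hD : D.card = 0) :
    2 ≤ A.card := by
  obtain rfl := Finset.card_eq_zero.mp hD
  obtain ⟨b, rfl⟩ := Finset.card_eq_one.mp hB
  obtain ⟨c, rfl⟩ := Finset.card_eq_one.mp hC
  obtain rfl : r (p.symm c) = b := by simpa using h'.middle (p.symm c)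
  have hne : p c ≠ r (p.symm c) := by simpa using hpr (p.symm c)
  have hne' : p.symm (r (p.symm c)) ≠ c := fun e => hne (by simpa using congrArg p e.symm)
  have hu : r c ∈ A := by simpa [hne] using h.last c
  have hv : r (p.symm (r (p.symm c))) ∈ A := by
    simpa [hne'] using h.middle (p.symm (r (p.symm c)))
  exact Finset.one_lt_card.mpr ⟨_, hu, _, hv, fun e => hne' (r.injective e).symm⟩

end Linked

/-- Round function `i` is fed by the output branch of round function `outputSource i`. -/
def outputSource : Equiv.Perm (Fin 8) where
  toFun := ![3, 6, 5, 1, 7, 4, 0, 2]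
  invFun := ![6, 3, 7, 0, 5, 2, 1, 4]
  left_inv := by decide
  right_inv := by decide

/-- The odd branch at block `i` is the even branch previously at block `inputSource i`. -/
def inputSource : Equiv.Perm (Fin 8) where
  toFun := ![1, 2, 4, 3, 0, 5, 7, 6]
  invFun := ![4, 0, 1, 3, 2, 5, 7, 6]
  left_inv := by decide
  right_inv := by decide

/-- The set of active round functions of a pattern. -/
def activeSet (b : Pattern) : Finset (Fin 8) :=
  Finset.univ.filter fun i => evenBr b i = true

theorem mem_activeSet {b : Pattern} {i : Fin 8} : i ∈ activeSet b ↔ evenBr b i = true := by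
  simp [activeSet]

theorem combine_shuffle_even (b : Pattern) (t : Fin 8 → Bool) (i : Fin 8) :
    evenBr (fun k => combine b t (shuffle k)) i = t (outputSource i) := by
  fin_cases i <;> rfl

theorem combine_shuffle_odd (b : Pattern) (t : Fin 8 → Bool) (i : Fin 8) :
    oddBr (fun k => combine b t (shuffle k)) i = evenBr b (inputSource i) := by
  fin_cases i <;> rfl

theorem Step.oddBr_eq {b b' : Pattern} (h : Step b b') (i : Fin 8) :
    oddBr b' i = evenBr b (inputSource i) := by
  obtain ⟨t, -, hb⟩ := h
  rw [funext hb, combine_shuffle_odd]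

/-- Among the two inputs and the output of a round function, not exactly one is active. -/
theorem Step.output_cases {b b' : Pattern} (h : Step b b') (i : Fin 8) :
    (evenBr b' i = true →
      evenBr b (outputSource i) = true ∨ oddBr b (outputSource i) = true) ∧
    (evenBr b (outputSource i) = true →
      evenBr b' i = true ∨ oddBr b (outputSource i) = true) ∧
    (oddBr b (outputSource i) = true →
      evenBr b' i = true ∨ evenBr b (outputSource i) = true) := by
  obtain ⟨t, ht, hb⟩ := h
  rw [funext hb, combine_shuffle_even]
  have := ht (outputSource i)
  revert this
  cases evenBr b (outputSource i) <;> cases oddBr b (outputSource i) <;>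
    cases t (outputSource i) <;> simp

theorem linked_activeSet {b b' b'' : Pattern} (h : Step b b') (h' : Step b' b'') :
    Linked outputSource (outputSource.trans inputSource)
      (activeSet b) (activeSet b') (activeSet b'') := by
  have hcases (i : Fin 8) := h'.output_cases i
  simp only [h.oddBr_eq, ← mem_activeSet] at hcases
  exact ⟨fun i => (hcases i).1, fun i => (hcases i).2.1, fun i => (hcases i).2.2⟩

theorem one_le_activeFuncs_add {b b' : Pattern} (h : Step b b') (hb : ∃ k, b k = true) :
    1 ≤ activeFuncs b + activeFuncs b' := by
  by_contra! hlt
  have hb0 : activeFuncs b = 0 := by omega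
  have hb1 : activeFuncs b' = 0 := by omega
  simp only [activeFuncs, Finset.card_eq_zero, Finset.filter_eq_empty_iff, Finset.mem_univ,
    true_implies] at hb0 hb1
  have hodd (i : Fin 8) : ¬ oddBr b i = true := fun hi => by
    obtain ⟨j, rfl⟩ := outputSource.surjective i
    exact ((h.output_cases j).2.2 hi).elim (hb1 (x := j)) (hb0 (x := outputSource j))
  obtain ⟨k, hk⟩ := hb
  obtain ⟨i, hi | hi⟩ : ∃ i : Fin 8, k.val = 2 * i.val ∨ k.val = 2 * i.val + 1 :=
    ⟨⟨k.val / 2, by omega⟩, by simp only; omega⟩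
  · exact hb0 (x := i) (by rw [← hk, evenBr]; congr 1; exact Fin.ext hi.symm)
  · exact hodd i (by rw [← hk, oddBr]; congr 1; exact Fin.ext hi.symm)

/-- The round in which two active inputs always cancel. -/
def cancelRound (b : Pattern) : Pattern := fun k =>
  combine b (fun i => xor (evenBr b i) (oddBr b i)) (shuffle k)

theorem step_cancelRound (b : Pattern) : Step b (cancelRound b) :=
  ⟨_, fun _ => ⟨fun h => by simp [h.1, h.2], id⟩, fun _ => rfl⟩

theorem six_rounds_min_active_eq_six :
    IsLeast {n : ℕ | ∃ b : ℕ → Pattern,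
      ValidTraj 6 b ∧ (∃ k, b 0 k = true) ∧ totalActive 6 b = n} 6 := by
  constructor
  · refine ⟨fun j => cancelRound^[j] (fun k => decide (k = 2 ∨ k = 3 ∨ k = 7)), fun j _ => ?_, ⟨2, rfl⟩, ?_⟩
    · simpa only [Function.iterate_succ_apply'] using step_cancelRound _
    · rfl
  · rintro n ⟨b, hb, hne, rfl⟩
    have hpr : ∀ i, outputSource (outputSource i) ≠ outputSource.trans inputSource i := by decide
    have hlink (j : ℕ) (hj : j + 1 < 6) :=
      linked_activeSet (hb j (by omega)) (hb (j + 1) hj)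
    obtain ⟨w, hw⟩ : ∃ w : ℕ → ℕ, ∀ j, (activeSet (b j)).card = w j := ⟨_, fun _ => rfl⟩
    have hstart : 1 ≤ w 0 + w 1 := by
      rw [← hw, ← hw]
      exact one_le_activeFuncs_add (hb 0 (by omega)) hne
    have htriangle (j : ℕ) (hj : j + 1 < 6) : w (j + 2) ≤ w (j + 1) + w j ∧
        w (j + 1) ≤ w (j + 2) + w j ∧ w j ≤ w (j + 2) + w (j + 1) := by
      simpa only [← hw] using
        ⟨(hlink j hj).card_last_le, (hlink j hj).card_middle_le, (hlink j hj).card_first_le⟩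
    have hgrowth (j : ℕ) (hj : j + 2 < 6) :
        (w j = 0 → w (j + 1) = 1 → w (j + 2) = 1 → 2 ≤ w (j + 3)) ∧
        (w (j + 1) = 1 → w (j + 2) = 1 → w (j + 3) = 0 → 2 ≤ w j) := by
      simpa only [← hw] using
        ⟨(hlink j (by omega)).two_le_card_last hpr (hlink (j + 1) hj),
          (hlink j (by omega)).two_le_card_first hpr (hlink (j + 1) hj)⟩
    have htotal : totalActive 6 b = w 0 + w 1 + w 2 + w 3 + w 4 + w 5 := by
      simp only [totalActive, Finset.sum_range_succ, Finset.sum_range_zero, zero_add, ← hw]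
      rfl
    have h₀ := htriangle 0
    have h₁ := htriangle 1
    have h₂ := htriangle 2
    have h₃ := htriangle 3
    have g₀ := hgrowth 0
    have g₁ := hgrowth 1
    have g₂ := hgrowth 2
    norm_num at h₀ h₁ h₂ h₃ g₀ g₁ g₂
    omega
end
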